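/- Let k be a field of characteristic zero and (S, ᵗ) a partial wheelspace. For n ≥ 1 and i, j ∈ {1,…,n}, define t^n_{j,i} : S(n) → S(n−1) by t^n_{j,i}(v) := ᵗⁿ((j … n)⁻¹ · v · (i … n)). Then the family (t^n_{j,i}) satisfies the axioms (W1) and (W2); consequently, S equipped with these contractions is a wheelspace with t^n_{n,n} = ᵗⁿ. -/

import Mathlib

/-- The cycle `(a … b)` inside the group of permutations of `ℕ` (1-indexed):
it sends `j` to `j + 1` for `a ≤ j < b`, sends `b` to `a`, and fixes every
other natural number. -/
def cyc (a b : ℕ) : Equiv.Perm ℕ :=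
  ((List.range' a (b - a)).map fun j => Equiv.swap j (j + 1)).prod

/-- Membership in `S_n ⊆ Perm ℕ` (1-indexed): `σ` fixes `0` and all `j > n`. -/
def memS (n : ℕ) (σ : Equiv.Perm ℕ) : Prop :=
  ∀ j : ℕ, j = 0 ∨ n < j → σ j = j

/-- `r^n_i(σ)`, realized inside `Perm ℕ` via the conjugation formula
`e_{n-1}(r^n_i(σ)) = (σ(i) … n)⁻¹ σ (i … n)` (for `σ ∈ S_n` this agrees with
the defining piecewise formula on `{1,…,n-1}` and fixes everything else). -/
def rP (n i : ℕ) (σ : Equiv.Perm ℕ) : Equiv.Perm ℕ :=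
  (cyc (σ i) n)⁻¹ * σ * cyc i n

/-- `l^n_i(σ) := (r^n_i(σ⁻¹))⁻¹`. -/
def lP (n i : ℕ) (σ : Equiv.Perm ℕ) : Equiv.Perm ℕ :=
  (rP n i σ⁻¹)⁻¹

/-- The block transposition `b_{a,b}(1 2) ∈ S_{a+b}` (1-indexed): it sends
`j ↦ j + b` for `1 ≤ j ≤ a`, `j ↦ j - a` for `a < j ≤ a + b`, and fixes
everything else. -/
def blockT (a b : ℕ) : Equiv.Perm ℕ := cyc 1 (a + b) ^ b

/-- The block-diagonal embedding `s_{n,m} : S_n × S_m → S_{n+m}`: `σ ∈ S_n`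
acts on `{1,…,n}` as itself and `σ' ∈ S_m` acts, shifted by `n`, on
`{n+1,…,n+m}`. -/
def sEmb (n m : ℕ) (σ σ' : Equiv.Perm ℕ) : Equiv.Perm ℕ :=
  σ * (blockT m n * σ' * (blockT m n)⁻¹)
/-- A diagonal `𝕊`-bimodule structure on the family of `k`-vector spaces `S`:
for each `n`, commuting `k`-linear left and right actions of `S_n` on `S n`,
the left action being `σ·v = L n σ v` and the right action `v·τ = R n τ v`
(only the values on permutations belonging to `S_n` are relevant). -/
def IsDiagAction (k : Type) [Field k] (S : ℕ → Type)
    [∀ n, AddCommGroup (S n)] [∀ n, Module k (S n)]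
    (L R : ∀ n, Equiv.Perm ℕ → S n →ₗ[k] S n) : Prop :=
  ∀ n : ℕ,
    (∀ v : S n, L n 1 v = v ∧ R n 1 v = v) ∧
    (∀ σ τ : Equiv.Perm ℕ, memS n σ → memS n τ → ∀ v : S n,
      L n (σ * τ) v = L n σ (L n τ v) ∧
      R n (σ * τ) v = R n τ (R n σ v) ∧
      L n σ (R n τ v) = R n τ (L n σ v))

/-- The family of contractions `t^{n+1}_{j,i} = t n j i : S (n+1) → S n`
(`1 ≤ i, j ≤ n+1`) makes the diagonal `𝕊`-bimodule `S` a wheelspace: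
axiom (W.1): `t^n_{j,i}(σ·v·τ) = l^n_j(σ) · t^n_{σ⁻¹(j),τ(i)}(v) · r^n_i(τ)`,
and axiom (W.2): `t^n_{j,i} ∘ t^{n+1}_{ℓ,k} = t^n_{j',i'} ∘ t^{n+1}_{ℓ',k'}`
where `(i',k') = (k-1,i)` if `i < k`, `(i',k') = (k,i+1)` if `k ≤ i`, and
`(j',ℓ')` is obtained from `(j,ℓ)` by the same rule. -/
def IsWheel (k : Type) [Field k] (S : ℕ → Type)
    [∀ n, AddCommGroup (S n)] [∀ n, Module k (S n)]
    (L R : ∀ n, Equiv.Perm ℕ → S n →ₗ[k] S n)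
    (t : ∀ n : ℕ, ℕ → ℕ → (S (n + 1) →ₗ[k] S n)) : Prop :=
  (∀ n i j : ℕ, 1 ≤ i → i ≤ n + 1 → 1 ≤ j → j ≤ n + 1 →
    ∀ σ τ : Equiv.Perm ℕ, memS (n + 1) σ → memS (n + 1) τ → ∀ v : S (n + 1),
      t n j i (L (n + 1) σ (R (n + 1) τ v)) =
        L n (lP (n + 1) j σ) (R n (rP (n + 1) i τ) (t n (σ⁻¹ j) (τ i) v))) ∧
  (∀ n i j a b : ℕ, 1 ≤ i → i ≤ n + 1 → 1 ≤ j → j ≤ n + 1 →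
    1 ≤ a → a ≤ n + 2 → 1 ≤ b → b ≤ n + 2 → ∀ v : S (n + 2),
      t n j i (t (n + 1) b a v) =
        t n (if j < b then b - 1 else b) (if i < a then a - 1 else a)
          (t (n + 1) (if j < b then j else j + 1) (if i < a then i else i + 1) v))
/-- The family of partial contractions `ᵗ^{n+1} = pt n : S (n+1) → S n` makes
the diagonal `𝕊`-bimodule `S` a partial wheelspace:
`ᵗⁿ(e_{n-1}(σ)·v·e_{n-1}(τ)) = σ·ᵗⁿ(v)·τ` for `σ, τ ∈ S_{n-1}` (the embedding
`e_{n-1} : S_{n-1} → S_n` being the obvious inclusion in `Perm ℕ`), and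
`ᵗⁿ(ᵗ^{n+1}((n n+1)·v·(n n+1))) = ᵗⁿ(ᵗ^{n+1}(v))`. -/
def IsPartialWheel (k : Type) [Field k] (S : ℕ → Type)
    [∀ n, AddCommGroup (S n)] [∀ n, Module k (S n)]
    (L R : ∀ n, Equiv.Perm ℕ → S n →ₗ[k] S n)
    (pt : ∀ n : ℕ, S (n + 1) →ₗ[k] S n) : Prop :=
  (∀ (n : ℕ) (σ τ : Equiv.Perm ℕ), memS n σ → memS n τ → ∀ v : S (n + 1),
      pt n (L (n + 1) σ (R (n + 1) τ v)) = L n σ (R n τ (pt n v))) ∧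
  (∀ (n : ℕ) (v : S (n + 2)),
      pt n (pt (n + 1)
          (L (n + 2) (Equiv.swap (n + 1) (n + 2))
            (R (n + 2) (Equiv.swap (n + 1) (n + 2)) v))) =
        pt n (pt (n + 1) v))

theorem cyc_self (a : ℕ) : cyc a a = 1 := by
  simp [cyc]

theorem cyc_succ_right {a b : ℕ} (h : a ≤ b) :
    cyc a (b + 1) = cyc a b * Equiv.swap b (b + 1) := by
  have hsub : b + 1 - a = (b - a) + 1 := by omega
  have hadd : a + (b - a) = b := by omega
  simp [cyc, hsub, List.range'_concat, hadd]

theorem cyc_apply {a b : ℕ} (h : a ≤ b) (x : ℕ) :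
    cyc a b x = if x = b then a else if a ≤ x ∧ x < b then x + 1 else x := by
  induction b, h using Nat.le_induction generalizing x with
  | base =>
    rw [cyc_self, Equiv.Perm.one_apply]
    split_ifs <;> omega
  | succ b h ih =>
    rw [cyc_succ_right h, Equiv.Perm.mul_apply, ih, Equiv.swap_apply_def]
    split_ifs <;> omega

theorem cyc_apply_right {a b : ℕ} (h : a ≤ b) : cyc a b b = a := by
  simp [cyc_apply h]

theorem memS.mono {m n : ℕ} (h : m ≤ n) {σ : Equiv.Perm ℕ} (hσ : memS m σ) : memS n σ :=
  fun x hx => hσ x (by omega)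

theorem memS.mul {n : ℕ} {σ τ : Equiv.Perm ℕ} (hσ : memS n σ) (hτ : memS n τ) :
    memS n (σ * τ) := fun x hx => by
  rw [Equiv.Perm.mul_apply, hτ x hx, hσ x hx]

theorem memS.inv {n : ℕ} {σ : Equiv.Perm ℕ} (hσ : memS n σ) : memS n σ⁻¹ := fun x hx => by
  rw [Equiv.Perm.inv_eq_iff_eq, hσ x hx]

theorem memS_cyc {a n : ℕ} (ha : 1 ≤ a) (h : a ≤ n) : memS n (cyc a n) := fun x hx => by
  rw [cyc_apply h]
  split_ifs <;> omega

theorem memS_swap_succ {n : ℕ} : memS (n + 2) (Equiv.swap (n + 1) (n + 2)) := fun x hx =>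
  Equiv.swap_apply_of_ne_of_ne (by omega) (by omega)

theorem memS_of_succ {n : ℕ} {σ : Equiv.Perm ℕ} (hσ : memS (n + 1) σ)
    (hfix : σ (n + 1) = n + 1) : memS n σ := fun x hx => by
  obtain rfl | hne := eq_or_ne x (n + 1)
  · exact hfix
  · exact hσ x (by omega)

/-- A permutation in `S_n` maps `{1,…,n}` to itself. -/
theorem memS.apply_mem {n : ℕ} {σ : Equiv.Perm ℕ} (hσ : memS n σ) {i : ℕ} (h1 : 1 ≤ i)
    (h2 : i ≤ n) : 1 ≤ σ i ∧ σ i ≤ n := by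
  by_contra hout
  have : σ i = i := σ.injective (hσ (σ i) (by omega))
  omega

theorem memS_rP {n i : ℕ} (h1 : 1 ≤ i) (h2 : i ≤ n + 1) {τ : Equiv.Perm ℕ}
    (hτ : memS (n + 1) τ) : memS n (rP (n + 1) i τ) := by
  obtain ⟨h3, h4⟩ := hτ.apply_mem h1 h2
  refine memS_of_succ (((memS_cyc h3 h4).inv.mul hτ).mul (memS_cyc h1 h2)) ?_
  rw [rP, Equiv.Perm.mul_apply, Equiv.Perm.mul_apply, cyc_apply_right h2,
    Equiv.Perm.inv_eq_iff_eq, cyc_apply_right h4]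

/-- Exchanging the order in which two positions are moved to the end. -/
theorem cyc_mul_cyc_exchange {n i a : ℕ} (hi : i ≤ n + 1) (ha : a ≤ n + 2) :
    cyc (if i < a then i else i + 1) (n + 2) * cyc (if i < a then a - 1 else a) (n + 1) =
      cyc a (n + 2) * cyc i (n + 1) * Equiv.swap (n + 1) (n + 2) := by
  ext x
  simp only [Equiv.Perm.mul_apply]
  split_ifs with h
  · rw [cyc_apply (by omega), cyc_apply (by omega), cyc_apply (by omega), cyc_apply (by omega),
      Equiv.swap_apply_def]
    split_ifs <;> omega
  · rw [cyc_apply (by omega), cyc_apply (by omega), cyc_apply (by omega), cyc_apply (by omega),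
      Equiv.swap_apply_def]
    split_ifs <;> omega

section Actions

variable {k : Type} [Field k] {S : ℕ → Type} [∀ n, AddCommGroup (S n)] [∀ n, Module k (S n)]
  {L R : ∀ n, Equiv.Perm ℕ → S n →ₗ[k] S n}

/-- Two successive two-sided actions combine into one. -/
theorem IsDiagAction.act_act (hLR : IsDiagAction k S L R) {n : ℕ} {σ σ' τ τ' : Equiv.Perm ℕ}
    (hσ : memS n σ) (hσ' : memS n σ') (hτ : memS n τ) (hτ' : memS n τ') (v : S n) :
    L n σ (R n τ (L n σ' (R n τ' v))) = L n (σ * σ') (R n (τ' * τ) v) := by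
  rw [((hLR n).2 σ σ' hσ hσ' _).1, ((hLR n).2 τ' τ hτ' hτ v).2.1,
    ((hLR n).2 σ' τ hσ' hτ (R n τ' v)).2.2]

variable {pt : ∀ n : ℕ, S (n + 1) →ₗ[k] S n}

theorem IsPartialWheel.contraction_act (hLR : IsDiagAction k S L R)
    (hpt : IsPartialWheel k S L R pt) {n i j : ℕ} (hi : 1 ≤ i) (hi' : i ≤ n + 1) (hj : 1 ≤ j)
    (hj' : j ≤ n + 1) {σ τ : Equiv.Perm ℕ} (hσ : memS (n + 1) σ) (hτ : memS (n + 1) τ)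
    (v : S (n + 1)) :
    pt n (L (n + 1) (cyc j (n + 1))⁻¹ (R (n + 1) (cyc i (n + 1))
        (L (n + 1) σ (R (n + 1) τ v)))) =
      L n (lP (n + 1) j σ) (R n (rP (n + 1) i τ)
        (pt n (L (n + 1) (cyc (σ⁻¹ j) (n + 1))⁻¹ (R (n + 1) (cyc (τ i) (n + 1)) v)))) := by
  have hr := memS_rP hi hi' hτ
  have hl : memS n (lP (n + 1) j σ) := (memS_rP hj hj' hσ.inv).inv
  have hτi := hτ.apply_mem hi hi'
  have hσj := hσ.inv.apply_mem hj hj'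
  rw [← hpt.1 n _ _ hl hr,
    hLR.act_act (hl.mono n.le_succ) (memS_cyc hσj.1 hσj.2).inv (hr.mono n.le_succ)
      (memS_cyc hτi.1 hτi.2),
    hLR.act_act (memS_cyc hj hj').inv hσ (memS_cyc hi hi') hτ]
  congr 3
  · simp [lP, rP, mul_assoc]
  · simp [rP, mul_assoc]

theorem IsPartialWheel.contraction_contraction (hLR : IsDiagAction k S L R)
    (hpt : IsPartialWheel k S L R pt) {n i j a b : ℕ} (hi : 1 ≤ i) (hi' : i ≤ n + 1)
    (hj : 1 ≤ j) (hj' : j ≤ n + 1) (ha : 1 ≤ a) (ha' : a ≤ n + 2) (hb : 1 ≤ b)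
    (hb' : b ≤ n + 2) (v : S (n + 2)) :
    pt n (L (n + 1) (cyc j (n + 1))⁻¹ (R (n + 1) (cyc i (n + 1))
        (pt (n + 1) (L (n + 2) (cyc b (n + 2))⁻¹ (R (n + 2) (cyc a (n + 2)) v))))) =
      pt n (pt (n + 1) (L (n + 2) (cyc b (n + 2) * cyc j (n + 1))⁻¹
        (R (n + 2) (cyc a (n + 2) * cyc i (n + 1)) v))) := by
  have hci := memS_cyc hi hi'
  have hcj := (memS_cyc hj hj').inv
  rw [← hpt.1 (n + 1) _ _ hcj hci,
    hLR.act_act (hcj.mono (n + 1).le_succ) (memS_cyc hb hb').inv (hci.mono (n + 1).le_succ)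
      (memS_cyc ha ha'), mul_inv_rev]

end Actions

/-- Lemma (partial wheelspaces give wheelspaces): if `(S, ᵗ)` is a partial
wheelspace and one defines `t^n_{j,i}(v) := ᵗⁿ((j … n)⁻¹ · v · (i … n))`, then
the family `(t^n_{j,i})` satisfies (W.1) and (W.2), i.e. `S` equipped with
these contractions is a wheelspace, and `t^n_{n,n} = ᵗⁿ`. -/
theorem partialWheelspace_gives_wheelspace (k : Type) [Field k] (S : ℕ → Type)
    [∀ n, AddCommGroup (S n)] [∀ n, Module k (S n)]
    (L R : ∀ n, Equiv.Perm ℕ → S n →ₗ[k] S n)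
    (hLR : IsDiagAction k S L R)
    (pt : ∀ n : ℕ, S (n + 1) →ₗ[k] S n)
    (hpt : IsPartialWheel k S L R pt) :
    IsWheel k S L R
      (fun n j i =>
        pt n ∘ₗ L (n + 1) (cyc j (n + 1))⁻¹ ∘ₗ R (n + 1) (cyc i (n + 1))) ∧
    ∀ (n : ℕ) (v : S (n + 1)),
      (pt n ∘ₗ L (n + 1) (cyc (n + 1) (n + 1))⁻¹ ∘ₗ
          R (n + 1) (cyc (n + 1) (n + 1))) v = pt n v := by
  refine ⟨⟨?_, ?_⟩, ?_⟩
  · intro n i j hi hi' hj hj' σ τ hσ hτ v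
    exact hpt.contraction_act hLR hi hi' hj hj' hσ hτ v
  · intro n i j a b hi hi' hj hj' ha ha' hb hb' v
    have hai := (memS_cyc ha ha').mul ((memS_cyc hi hi').mono (n + 1).le_succ)
    have hbj := (memS_cyc hb hb').mul ((memS_cyc hj hj').mono (n + 1).le_succ)
    simp only [LinearMap.comp_apply]
    rw [hpt.contraction_contraction hLR hi hi' hj hj' ha ha' hb hb',
      hpt.contraction_contraction hLR (by split_ifs <;> omega) (by split_ifs <;> omega)
        (by split_ifs <;> omega) (by split_ifs <;> omega) (by split_ifs <;> omega)
        (by split_ifs <;> omega) (by split_ifs <;> omega) (by split_ifs <;> omega),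
      cyc_mul_cyc_exchange hi' ha', cyc_mul_cyc_exchange hj' hb', mul_inv_rev _ (Equiv.swap _ _),
      Equiv.swap_inv, ← hLR.act_act memS_swap_succ hbj.inv memS_swap_succ hai, hpt.2]
  · intro n v
    simp [cyc_self, ((hLR (n + 1)).1 _).1, ((hLR (n + 1)).1 _).2]
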